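/- arXiv:1804.01074 — 10 statements merged into one kernel-verified Lean document; each statement's English description precedes it below -/
import Mathlib

section
/- Let H(q₁,q₂,p₁,p₂) = (1/2)(p₁² + p₂²) + (1/2)q₁² + (1/18)q₂² be the Fokas–Lagerstrom Hamiltonian on ℝ⁴. Then the cubic function C_I = p₂²(q₁p₂ − q₂p₁) + (1/27)q₂³p₁ − (1/3)q₁q₂²p₂ satisfies {H, C_I} = 0, i.e. C_I is a constant of motion. -/
/-- Canonical Poisson bracket on ℝ⁴ with coordinates (q₁, q₂, p₁, p₂):
`{F,G} = Σ_{i=1,2} (∂F/∂q_i ∂G/∂p_i − ∂F/∂p_i ∂G/∂q_i)`. -/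
noncomputable def poissonBracket (F G : ℝ → ℝ → ℝ → ℝ → ℝ) (q₁ q₂ p₁ p₂ : ℝ) : ℝ :=
    deriv (fun x => F x q₂ p₁ p₂) q₁ * deriv (fun x => G q₁ q₂ x p₂) p₁
  + deriv (fun x => F q₁ x p₁ p₂) q₂ * deriv (fun x => G q₁ q₂ p₁ x) p₂
  - deriv (fun x => F q₁ q₂ x p₂) p₁ * deriv (fun x => G x q₂ p₁ p₂) q₁
  - deriv (fun x => F q₁ q₂ p₁ x) p₂ * deriv (fun x => G q₁ x p₁ p₂) q₂

theorem deriv_cubic_aux (f : ℝ → ℝ) (a b c d x : ℝ)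
    (h : ∀ y, f y = a + b * y + c * y^2 + d * y^3) :
    deriv f x = b + 2 * c * x + 3 * d * x^2 := by
  have hf : f = fun y => a + b * y + c * y^2 + d * y^3 := funext h
  rw [hf]
  have h1 := ((((hasDerivAt_id' x).const_mul b).const_add a).add
    ((hasDerivAt_pow 2 x).const_mul c)).add ((hasDerivAt_pow 3 x).const_mul d)
  refine (HasDerivAt.deriv (f := fun y => a + b * y + c * y^2 + d * y^3) h1).trans ?_
  norm_num
  ring

/-- The cubic function `C_I` is a constant of motion of the Fokas–Lagerstrom Hamiltonian. -/
theorem fokas_lagerstrom_CI_constant_of_motion :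
    ∀ q₁ q₂ p₁ p₂ : ℝ,
      poissonBracket
        (fun q₁ q₂ p₁ p₂ => (1/2) * (p₁^2 + p₂^2) + (1/2) * q₁^2 + (1/18) * q₂^2)
        (fun q₁ q₂ p₁ p₂ =>
          p₂^2 * (q₁ * p₂ - q₂ * p₁) + (1/27) * q₂^3 * p₁ - (1/3) * q₁ * q₂^2 * p₂)
        q₁ q₂ p₁ p₂ = 0 := by
  intro q₁ q₂ p₁ p₂
  unfold poissonBracket
  rw [deriv_cubic_aux _ ((1/2) * (p₁^2 + p₂^2) + (1/18) * q₂^2) 0 (1/2) 0 q₁ (by intro y; ring),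
    deriv_cubic_aux _ (p₂^2 * (q₁ * p₂) - (1/3) * q₁ * q₂^2 * p₂)
      (-p₂^2 * q₂ + (1/27) * q₂^3) 0 0 p₁ (by intro y; ring),
    deriv_cubic_aux _ ((1/2) * (p₁^2 + p₂^2) + (1/2) * q₁^2) 0 (1/18) 0 q₂ (by intro y; ring),
    deriv_cubic_aux _ ((1/27) * q₂^3 * p₁) (-(1/3) * q₁ * q₂^2) (-q₂ * p₁) q₁ p₂
      (by intro y; ring),
    deriv_cubic_aux _ ((1/2) * p₂^2 + (1/2) * q₁^2 + (1/18) * q₂^2) 0 (1/2) 0 p₁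
      (by intro y; ring),
    deriv_cubic_aux _ (-p₂^2 * q₂ * p₁ + (1/27) * q₂^3 * p₁) (p₂^3 - (1/3) * q₂^2 * p₂) 0 0 q₁
      (by intro y; ring),
    deriv_cubic_aux _ ((1/2) * p₁^2 + (1/2) * q₁^2 + (1/18) * q₂^2) 0 (1/2) 0 p₂
      (by intro y; ring),
    deriv_cubic_aux _ (p₂^3 * q₁) (-p₂^2 * p₁) (-(1/3) * q₁ * p₂) ((1/27) * p₁) q₂
      (by intro y; ring)]
  ring
end

section
/- Let δ ∈ ℝ and let H(q₁,q₂,p₁,p₂) = (1/2)(p₁² + p₂²) + (1/2)(q₁² + 4q₂²) + δ/q₁² be the Holt Hamiltonian on the open set {q₁ ≠ 0} ⊂ ℝ⁴. Then the cubic function F = p₁²p₂ − q₁²p₂ + (2δ/q₁²)p₂ + 4q₁q₂p₁ satisfies {H, F} = 0 on {q₁ ≠ 0}, i.e. F is a constant of motion. -/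
/-- The cubic function `F = p₁²p₂ − q₁²p₂ + (2δ/q₁²)p₂ + 4q₁q₂p₁` is a constant of motion
of the Holt Hamiltonian on `{q₁ ≠ 0}`. -/
theorem holt_cubic_constant_of_motion (δ : ℝ) :
    ∀ q₁ q₂ p₁ p₂ : ℝ, q₁ ≠ 0 →
      poissonBracket
        (fun q₁ q₂ p₁ p₂ =>
          (1/2) * (p₁^2 + p₂^2) + (1/2) * (q₁^2 + 4 * q₂^2) + δ / q₁^2)
        (fun q₁ q₂ p₁ p₂ =>
          p₁^2 * p₂ - q₁^2 * p₂ + (2 * δ / q₁^2) * p₂ + 4 * q₁ * q₂ * p₁)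
        q₁ q₂ p₁ p₂ = 0 := by
  intro q₁ q₂ p₁ p₂ h
  have h2 : q₁^2 ≠ 0 := pow_ne_zero 2 h
  have sq : ∀ x : ℝ, HasDerivAt (fun x : ℝ => x^2) (2*x) x := fun x => by
    simpa using hasDerivAt_pow 2 x
  have dv : ∀ c : ℝ, HasDerivAt (fun x : ℝ => c / x^2) (-2*c/q₁^3) q₁ := fun c => by
    refine ((hasDerivAt_const q₁ c).div (sq q₁) h2).congr_deriv ?_
    field_simp
    ring
  have a1 := (((sq q₁).add_const (4*q₂^2)).const_mul (1/2)).const_add ((1/2)*(p₁^2+p₂^2)) |>.add (dv δ)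
  have a2 := ((((sq q₂).const_mul 4).const_add (q₁^2)).const_mul (1/2)).const_add ((1/2)*(p₁^2+p₂^2)) |>.add_const (δ/q₁^2)
  have a3 := (((sq p₁).add_const (p₂^2)).const_mul (1/2)).add_const ((1/2)*(q₁^2+4*q₂^2)) |>.add_const (δ/q₁^2)
  have a4 := (((sq p₂).const_add (p₁^2)).const_mul (1/2)).add_const ((1/2)*(q₁^2+4*q₂^2)) |>.add_const (δ/q₁^2)
  have b1 := ((((sq q₁).mul_const p₂).const_sub (p₁^2*p₂)).add ((dv (2*δ)).mul_const p₂)).add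
    ((((hasDerivAt_id' q₁).const_mul 4).mul_const q₂).mul_const p₁)
  have b2 := (((hasDerivAt_id' q₂).const_mul (4*q₁)).mul_const p₁).const_add
    (p₁^2*p₂ - q₁^2*p₂ + (2*δ/q₁^2)*p₂)
  have b3 := ((((sq p₁).mul_const p₂).sub_const (q₁^2*p₂)).add_const ((2*δ/q₁^2)*p₂)).add
    ((hasDerivAt_id' p₁).const_mul (4*q₁*q₂))
  have b4 := ((((hasDerivAt_id' p₂).const_mul (p₁^2)).sub ((hasDerivAt_id' p₂).const_mul (q₁^2))).add
    ((hasDerivAt_id' p₂).const_mul (2*δ/q₁^2))).add_const (4*q₁*q₂*p₁)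
  have e : ∀ {f : ℝ → ℝ} {d x : ℝ}, HasDerivAt f d x → deriv f x = d := fun h => h.deriv
  unfold poissonBracket
  refine Eq.trans (congrArg₂ (· - ·) (congrArg₂ (· - ·) (congrArg₂ (· + ·)
    (congrArg₂ (· * ·) (e a1) (e b3)) (congrArg₂ (· * ·) (e a2) (e b4)))
    (congrArg₂ (· * ·) (e a3) (e b1))) (congrArg₂ (· * ·) (e a4) (e b2))) ?_
  field_simp
  ring
end

section
/- Let ω₀ ∈ ℝ and let H(q₁,q₂,p₁,p₂) = p₁²/(2q₁²) + (1/2)p₂²q₂⁴ + (1/2)ω₀²q₁⁴ + 2ω₀²/q₂² be the position-dependent-mass anisotropic oscillator Hamiltonian (masses m₁ = q₁², m₂ = q₂⁻⁴) on the open set {q₁ ≠ 0, q₂ ≠ 0} ⊂ ℝ⁴. Then the function I₃ = p₁p₂q₂²/q₁ − 2ω₀²q₁²/q₂ satisfies {H, I₃} = 0. -/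
/-- For the position-dependent-mass anisotropic oscillator with masses `m₁ = q₁²`,
`m₂ = q₂⁻⁴`, the function `I₃ = p₁p₂q₂²/q₁ − 2ω₀²q₁²/q₂` is a constant of motion on
`{q₁ ≠ 0, q₂ ≠ 0}`. -/
theorem pdm_oscillator_I3_constant_of_motion (ω₀ : ℝ) :
    ∀ q₁ q₂ p₁ p₂ : ℝ, q₁ ≠ 0 → q₂ ≠ 0 →
      poissonBracket
        (fun q₁ q₂ p₁ p₂ =>
          p₁^2 / (2 * q₁^2) + (1/2) * p₂^2 * q₂^4 + (1/2) * ω₀^2 * q₁^4 + 2 * ω₀^2 / q₂^2)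
        (fun q₁ q₂ p₁ p₂ => p₁ * p₂ * q₂^2 / q₁ - 2 * ω₀^2 * q₁^2 / q₂)
        q₁ q₂ p₁ p₂ = 0 := by
  intro q₁ q₂ p₁ p₂ h1 h2
  have hid : ∀ x : ℝ, HasDerivAt (fun y : ℝ => y) 1 x := fun x => hasDerivAt_id' x
  have a1 := ((((hasDerivAt_const q₁ (p₁^2)).div (((hid q₁).pow 2).const_mul 2)
    (by simpa using h1)).add_const ((1/2) * p₂^2 * q₂^4)).add
    (((hid q₁).pow 4).const_mul ((1/2) * ω₀^2))).add_const (2 * ω₀^2 / q₂^2)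
  have a2 := (((((hid q₂).pow 4).const_mul ((1/2) * p₂^2)).const_add
    (p₁^2 / (2 * q₁^2))).add_const ((1/2) * ω₀^2 * q₁^4)).add
    ((hasDerivAt_const q₂ (2 * ω₀^2)).div ((hid q₂).pow 2) (by simpa using h2))
  have a3 := (((((hid p₁).pow 2).div_const (2 * q₁^2)).add_const
    ((1/2) * p₂^2 * q₂^4)).add_const ((1/2) * ω₀^2 * q₁^4)).add_const (2 * ω₀^2 / q₂^2)
  have a4 := ((((((hid p₂).pow 2).const_mul (1/2)).mul_const (q₂^4)).const_add
    (p₁^2 / (2 * q₁^2))).add_const ((1/2) * ω₀^2 * q₁^4)).add_const (2 * ω₀^2 / q₂^2)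
  have b1 := ((hasDerivAt_const q₁ (p₁ * p₂ * q₂^2)).div (hid q₁) h1).sub
    ((((hid q₁).pow 2).const_mul (2 * ω₀^2)).div_const q₂)
  have b2 := ((((hid q₂).pow 2).const_mul (p₁ * p₂)).div_const q₁).sub
    ((hasDerivAt_const q₂ (2 * ω₀^2 * q₁^2)).div (hid q₂) h2)
  have b3 := (((((hid p₁).mul_const p₂).mul_const (q₂^2)).div_const q₁).sub_const
    (2 * ω₀^2 * q₁^2 / q₂))
  have b4 := (((((hid p₂).const_mul p₁).mul_const (q₂^2)).div_const q₁).sub_const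
    (2 * ω₀^2 * q₁^2 / q₂))
  unfold poissonBracket
  refine (congrArg₂ (· - ·) (congrArg₂ (· - ·) (congrArg₂ (· + ·)
    (congrArg₂ (· * ·) a1.deriv b3.deriv) (congrArg₂ (· * ·) a2.deriv b4.deriv))
    (congrArg₂ (· * ·) a3.deriv b1.deriv)) (congrArg₂ (· * ·) a4.deriv b2.deriv)).trans ?_
  simp
  field_simp
  ring
end

section
/- Let ω₀ ∈ ℝ and let H(q₁,q₂,p₁,p₂) = p₁²/(2q₁²) + (1/2)p₂²q₂⁴ + (1/2)ω₀²q₁⁴ + 2ω₀²/q₂² be the position-dependent-mass anisotropic oscillator Hamiltonian on the open set {q₁ ≠ 0, q₂ ≠ 0} ⊂ ℝ⁴. Then the function I₄ = q₁²q₂²p₂ + 2p₁/(q₁q₂) satisfies {H, I₄} = 0. -/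
/-- For the position-dependent-mass anisotropic oscillator with masses `m₁ = q₁²`,
`m₂ = q₂⁻⁴`, the function `I₄ = q₁²q₂²p₂ + 2p₁/(q₁q₂)` is a constant of motion on
`{q₁ ≠ 0, q₂ ≠ 0}`. -/
theorem pdm_oscillator_I4_constant_of_motion (ω₀ : ℝ) :
    ∀ q₁ q₂ p₁ p₂ : ℝ, q₁ ≠ 0 → q₂ ≠ 0 →
      poissonBracket
        (fun q₁ q₂ p₁ p₂ =>
          p₁^2 / (2 * q₁^2) + (1/2) * p₂^2 * q₂^4 + (1/2) * ω₀^2 * q₁^4 + 2 * ω₀^2 / q₂^2)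
        (fun q₁ q₂ p₁ p₂ => q₁^2 * q₂^2 * p₂ + 2 * p₁ / (q₁ * q₂))
        q₁ q₂ p₁ p₂ = 0 := by
  intro q₁ q₂ p₁ p₂ h1 h2
  have d := hasDerivAt_id' (𝕜 := ℝ)
  have a1 : HasDerivAt (fun x : ℝ => p₁^2 / (2 * x^2) + (1/2) * p₂^2 * q₂^4
      + (1/2) * ω₀^2 * x^4 + 2 * ω₀^2 / q₂^2) _ q₁ :=
    ((((hasDerivAt_const q₁ (p₁^2)).fun_div (((d q₁).fun_pow 2).const_mul 2)
      (by positivity)).add_const _).fun_add (((d q₁).fun_pow 4).const_mul _)).add_const _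
  have a2 : HasDerivAt (fun x : ℝ => p₁^2 / (2 * q₁^2) + (1/2) * p₂^2 * x^4
      + (1/2) * ω₀^2 * q₁^4 + 2 * ω₀^2 / x^2) _ q₂ :=
    (((((d q₂).fun_pow 4).const_mul _).const_add _).add_const _).fun_add
      ((hasDerivAt_const q₂ (2 * ω₀^2)).fun_div ((d q₂).fun_pow 2) (by positivity))
  have a3 : HasDerivAt (fun x : ℝ => x^2 / (2 * q₁^2) + (1/2) * p₂^2 * q₂^4
      + (1/2) * ω₀^2 * q₁^4 + 2 * ω₀^2 / q₂^2) _ p₁ :=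
    (((((d p₁).fun_pow 2).div_const _).add_const _).add_const _).add_const _
  have a4 : HasDerivAt (fun x : ℝ => p₁^2 / (2 * q₁^2) + (1/2) * x^2 * q₂^4
      + (1/2) * ω₀^2 * q₁^4 + 2 * ω₀^2 / q₂^2) _ p₂ :=
    ((((((d p₂).fun_pow 2).const_mul _).mul_const _).const_add _).add_const _).add_const _
  have b1 : HasDerivAt (fun x : ℝ => x^2 * q₂^2 * p₂ + 2 * p₁ / (x * q₂)) _ q₁ :=
    ((((d q₁).fun_pow 2).mul_const _).mul_const _).fun_add
      ((hasDerivAt_const q₁ (2 * p₁)).fun_div ((d q₁).mul_const q₂) (mul_ne_zero h1 h2))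
  have b2 : HasDerivAt (fun x : ℝ => q₁^2 * x^2 * p₂ + 2 * p₁ / (q₁ * x)) _ q₂ :=
    ((((d q₂).fun_pow 2).const_mul _).mul_const _).fun_add
      ((hasDerivAt_const q₂ (2 * p₁)).fun_div ((d q₂).const_mul q₁) (mul_ne_zero h1 h2))
  have b3 : HasDerivAt (fun x : ℝ => q₁^2 * q₂^2 * p₂ + 2 * x / (q₁ * q₂)) _ p₁ :=
    (((d p₁).const_mul _).div_const _).const_add _
  have b4 : HasDerivAt (fun x : ℝ => q₁^2 * q₂^2 * x + 2 * p₁ / (q₁ * q₂)) _ p₂ :=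
    ((d p₂).const_mul _).add_const _
  simp only [poissonBracket]
  rw [a1.deriv, a2.deriv, a3.deriv, a4.deriv, b1.deriv, b2.deriv, b3.deriv, b4.deriv]
  norm_num
  field_simp
  ring
end

section
/- Let ω₀ ∈ ℝ and consider, on the open set {q₁ ≠ 0, q₂ ≠ 0} ⊂ ℝ⁴, the one-dimensional energy I₁ = p₁²/(2q₁²) + (1/2)ω₀²q₁⁴ and the first integrals I₃ = p₁p₂q₂²/q₁ − 2ω₀²q₁²/q₂ and I₄ = q₁²q₂²p₂ + 2p₁/(q₁q₂) of the position-dependent-mass anisotropic oscillator H = p₁²/(2q₁²) + (1/2)p₂²q₂⁴ + (1/2)ω₀²q₁⁴ + 2ω₀²/q₂². Then the Poisson bracket of I₁ with I₄ is proportional to I₃; precisely, {I₁, I₄} = −2 I₃. -/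
/-- For the position-dependent-mass anisotropic oscillator, the Poisson bracket of the
one-dimensional energy `I₁ = p₁²/(2q₁²) + (1/2)ω₀²q₁⁴` with
`I₄ = q₁²q₂²p₂ + 2p₁/(q₁q₂)` is `−2 I₃` where `I₃ = p₁p₂q₂²/q₁ − 2ω₀²q₁²/q₂`. -/
theorem pdm_oscillator_bracket_I1_I4 (ω₀ : ℝ) :
    ∀ q₁ q₂ p₁ p₂ : ℝ, q₁ ≠ 0 → q₂ ≠ 0 →
      poissonBracket
        (fun q₁ q₂ p₁ p₂ => p₁^2 / (2 * q₁^2) + (1/2) * ω₀^2 * q₁^4)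
        (fun q₁ q₂ p₁ p₂ => q₁^2 * q₂^2 * p₂ + 2 * p₁ / (q₁ * q₂))
        q₁ q₂ p₁ p₂
      = -2 * (p₁ * p₂ * q₂^2 / q₁ - 2 * ω₀^2 * q₁^2 / q₂) := by
  intro q₁ q₂ p₁ p₂ h1 h2
  have hF1 : HasDerivAt (fun x : ℝ => p₁^2 / (2 * x^2) + (1/2) * ω₀^2 * x^4)
      (-p₁^2 / q₁^3 + 2 * ω₀^2 * q₁^3) q₁ := by
    have ha := (hasDerivAt_const q₁ (p₁^2)).div ((hasDerivAt_pow 2 q₁).const_mul 2)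
      (by positivity)
    have hb := (hasDerivAt_pow 4 q₁).const_mul ((1/2) * ω₀^2)
    refine (ha.add hb).congr_deriv ?_
    field_simp
    norm_num
    ring
  have hG3 : HasDerivAt (fun x : ℝ => q₁^2 * q₂^2 * p₂ + 2 * x / (q₁ * q₂))
      (2 / (q₁ * q₂)) p₁ := by
    have hb := (((hasDerivAt_id p₁).const_mul 2).div_const (q₁ * q₂)).const_add
      (q₁^2 * q₂^2 * p₂)
    exact hb.congr_deriv (by ring)
  have hF3 : HasDerivAt (fun x : ℝ => x^2 / (2 * q₁^2) + (1/2) * ω₀^2 * q₁^4)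
      (p₁ / q₁^2) p₁ := by
    have ha := ((hasDerivAt_pow 2 p₁).div_const (2 * q₁^2)).add_const
      ((1/2) * ω₀^2 * q₁^4)
    refine ha.congr_deriv ?_
    field_simp
    norm_num
  have hG1 : HasDerivAt (fun x : ℝ => x^2 * q₂^2 * p₂ + 2 * p₁ / (x * q₂))
      (2 * q₁ * q₂^2 * p₂ - 2 * p₁ / (q₁^2 * q₂)) q₁ := by
    have ha := ((hasDerivAt_pow 2 q₁).mul_const (q₂^2)).mul_const p₂
    have hb := (hasDerivAt_const q₁ (2 * p₁)).div ((hasDerivAt_id q₁).mul_const q₂)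
      (mul_ne_zero h1 h2)
    refine (ha.add hb).congr_deriv ?_
    simp only [id]
    field_simp
    norm_num
    try ring
  simp only [poissonBracket]
  rw [hF1.deriv, hG3.deriv, hF3.deriv, hG1.deriv, deriv_const, deriv_const]
  field_simp
  ring
end

section
/- Let ω₀ ∈ ℝ. Define on the open set {q₁ > 0, q₂ > 0} ⊂ ℝ⁴ the transformation Q₁ = q₁²/2, P₁ = p₁/q₁, Q₂ = −1/q₂, P₂ = p₂q₂². Then (i) the transformation is canonical: {Q₁,P₁} = {Q₂,P₂} = 1 and {Q₁,Q₂} = {P₁,P₂} = {Q₁,P₂} = {Q₂,P₁} = 0; and (ii) the position-dependent-mass Hamiltonian H = p₁²/(2q₁²) + (1/2)p₂²q₂⁴ + (1/2)ω₀²q₁⁴ + 2ω₀²/q₂² is transformed into the isotropic harmonic oscillator of frequency 2ω₀, i.e. H(q₁,q₂,p₁,p₂) = (1/2)P₁² + (1/2)(2ω₀)²Q₁² + (1/2)P₂² + (1/2)(2ω₀)²Q₂² identically on {q₁ > 0, q₂ > 0}. -/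
/-- `Q₁ = q₁²/2` as a function on phase space. -/
noncomputable def Q1 : ℝ → ℝ → ℝ → ℝ → ℝ := fun q₁ _ _ _ => q₁^2 / 2
/-- `P₁ = p₁/q₁` as a function on phase space. -/
noncomputable def P1 : ℝ → ℝ → ℝ → ℝ → ℝ := fun q₁ _ p₁ _ => p₁ / q₁
/-- `Q₂ = −1/q₂` as a function on phase space. -/
noncomputable def Q2 : ℝ → ℝ → ℝ → ℝ → ℝ := fun _ q₂ _ _ => -(1 / q₂)
/-- `P₂ = p₂q₂²` as a function on phase space. -/
noncomputable def P2 : ℝ → ℝ → ℝ → ℝ → ℝ := fun _ q₂ _ p₂ => p₂ * q₂^2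

/-- The transformation `Q₁ = q₁²/2, P₁ = p₁/q₁, Q₂ = −1/q₂, P₂ = p₂q₂²` is canonical on
`{q₁ > 0, q₂ > 0}` and maps the position-dependent-mass anisotropic oscillator
`H = p₁²/(2q₁²) + (1/2)p₂²q₂⁴ + (1/2)ω₀²q₁⁴ + 2ω₀²/q₂²` to the isotropic harmonic
oscillator of frequency `2ω₀`. -/
theorem pdm_oscillator_duality (ω₀ : ℝ) :
    ∀ q₁ q₂ p₁ p₂ : ℝ, 0 < q₁ → 0 < q₂ →
      (poissonBracket Q1 P1 q₁ q₂ p₁ p₂ = 1 ∧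
       poissonBracket Q2 P2 q₁ q₂ p₁ p₂ = 1 ∧
       poissonBracket Q1 Q2 q₁ q₂ p₁ p₂ = 0 ∧
       poissonBracket P1 P2 q₁ q₂ p₁ p₂ = 0 ∧
       poissonBracket Q1 P2 q₁ q₂ p₁ p₂ = 0 ∧
       poissonBracket Q2 P1 q₁ q₂ p₁ p₂ = 0) ∧
      p₁^2 / (2 * q₁^2) + (1/2) * p₂^2 * q₂^4 + (1/2) * ω₀^2 * q₁^4 + 2 * ω₀^2 / q₂^2
        = (1/2) * (P1 q₁ q₂ p₁ p₂)^2 + (1/2) * (2 * ω₀)^2 * (Q1 q₁ q₂ p₁ p₂)^2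
          + (1/2) * (P2 q₁ q₂ p₁ p₂)^2 + (1/2) * (2 * ω₀)^2 * (Q2 q₁ q₂ p₁ p₂)^2 := by
  intro q₁ q₂ p₁ p₂ h1 h2
  have n1 : q₁ ≠ 0 := h1.ne'
  have n2 : q₂ ≠ 0 := h2.ne'
  have d1 : deriv (fun x : ℝ => x^2 / 2) q₁ = q₁ := by
    have h := ((hasDerivAt_pow 2 q₁).div_const 2).deriv
    rw [h]; norm_num
  have d2 : deriv (fun x : ℝ => x / q₁) p₁ = 1 / q₁ :=
    ((hasDerivAt_id' p₁).div_const q₁).deriv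
  have d3 : deriv (fun x : ℝ => -(1 / x)) q₂ = 1 / q₂^2 := by
    have h := (hasDerivAt_inv n2).neg.deriv
    simp only [one_div]
    refine Eq.trans h ?_
    simp
  have d4 : deriv (fun x : ℝ => x * q₂^2) p₂ = q₂^2 := by
    have h := ((hasDerivAt_id' p₂).mul_const (q₂^2)).deriv
    rw [h, one_mul]
  refine ⟨⟨?_, ?_, ?_, ?_, ?_, ?_⟩, ?_⟩
  · simp only [poissonBracket, Q1, P1, d1, d2, deriv_const]
    field_simp
    ring
  · simp only [poissonBracket, Q2, P2, d3, d4, deriv_const]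
    field_simp
    ring
  · simp only [poissonBracket, Q1, Q2, deriv_const]
    ring
  · simp only [poissonBracket, P1, P2, deriv_const]
    ring
  · simp only [poissonBracket, Q1, P2, deriv_const]
    ring
  · simp only [poissonBracket, Q2, P1, deriv_const]
    ring
  · simp only [Q1, Q2, P1, P2]
    field_simp
    ring
end

section
/- Let ω₀ > 0, let n₁, n₂ be positive integers, let k₁ > 0, k₂ ∈ ℝ, and let H = (1/2)(p₁² + p₂²) + (1/2)ω₀²(n₁²q₁² + n₂²q₂²) + k₁/(2q₁²) + k₂q₂ on {q₁ ≠ 0} ⊂ ℝ⁴, with separated energies I₁(q₁,p₁) = (1/2)p₁² + (1/2)ω₀²n₁²q₁² + k₁/(2q₁²) and I₂(q₂,p₂) = (1/2)p₂² + (1/2)ω₀²n₂²q₂² + k₂q₂. Define z₁ = (ω₀n₁/√2)(q₁² − I₁/(ω₀²n₁²)) / √(I₁²/(2ω₀²n₁²) − k₁/2) and z₂ = (ω₀n₂/√2)(q₂ + k₂/(ω₀²n₂²)) / √(I₂ + k₂²/(2ω₀²n₂²)), and X = (1/(2ω₀n₁)) arcsin(z₁) − (1/(ω₀n₂)) arcsin(z₂).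 Then on the open region where q₁ > 0, p₁ > 0 and p₂ > 0, the function X is well defined (both arcsin arguments lie in (−1,1)) and satisfies {H, X} = 0, i.e. X is a constant of motion. -/
/-- Separated energy `I₁ = (1/2)p₁² + (1/2)ω₀²n₁²q₁² + k₁/(2q₁²)`. -/
noncomputable def Ione (ω₀ : ℝ) (n₁ : ℕ) (k₁ : ℝ) (q₁ p₁ : ℝ) : ℝ :=
  (1/2) * p₁^2 + (1/2) * ω₀^2 * (n₁ : ℝ)^2 * q₁^2 + k₁ / (2 * q₁^2)

/-- Separated energy `I₂ = (1/2)p₂² + (1/2)ω₀²n₂²q₂² + k₂q₂`. -/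
noncomputable def Itwo (ω₀ : ℝ) (n₂ : ℕ) (k₂ : ℝ) (q₂ p₂ : ℝ) : ℝ :=
  (1/2) * p₂^2 + (1/2) * ω₀^2 * (n₂ : ℝ)^2 * q₂^2 + k₂ * q₂

/-- `z₁ = (ω₀n₁/√2)(q₁² − I₁/(ω₀²n₁²)) / √(I₁²/(2ω₀²n₁²) − k₁/2)`. -/
noncomputable def zOne (ω₀ : ℝ) (n₁ : ℕ) (k₁ : ℝ) (q₁ p₁ : ℝ) : ℝ :=
  (ω₀ * (n₁ : ℝ) / Real.sqrt 2) * (q₁^2 - Ione ω₀ n₁ k₁ q₁ p₁ / (ω₀^2 * (n₁ : ℝ)^2))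
    / Real.sqrt ((Ione ω₀ n₁ k₁ q₁ p₁)^2 / (2 * ω₀^2 * (n₁ : ℝ)^2) - k₁ / 2)

/-- `z₂ = (ω₀n₂/√2)(q₂ + k₂/(ω₀²n₂²)) / √(I₂ + k₂²/(2ω₀²n₂²))`. -/
noncomputable def zTwo (ω₀ : ℝ) (n₂ : ℕ) (k₂ : ℝ) (q₂ p₂ : ℝ) : ℝ :=
  (ω₀ * (n₂ : ℝ) / Real.sqrt 2) * (q₂ + k₂ / (ω₀^2 * (n₂ : ℝ)^2))
    / Real.sqrt (Itwo ω₀ n₂ k₂ q₂ p₂ + k₂^2 / (2 * ω₀^2 * (n₂ : ℝ)^2))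

/-- `X = (1/(2ω₀n₁)) arcsin z₁ − (1/(ω₀n₂)) arcsin z₂`, the difference of angle variables. -/
noncomputable def Xint (ω₀ : ℝ) (n₁ n₂ : ℕ) (k₁ k₂ : ℝ) (q₁ q₂ p₁ p₂ : ℝ) : ℝ :=
  (1 / (2 * ω₀ * (n₁ : ℝ))) * Real.arcsin (zOne ω₀ n₁ k₁ q₁ p₁)
    - (1 / (ω₀ * (n₂ : ℝ))) * Real.arcsin (zTwo ω₀ n₂ k₂ q₂ p₂)

theorem hasDerivAt_arcsin_aux (u D : ℝ → ℝ) (u' d' r x : ℝ) (hu : HasDerivAt u u' x)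
    (hd : HasDerivAt D d' x) (hr : 0 < r) (h : D x = u x ^ 2 + r ^ 2) :
    u x / √(D x) ∈ Set.Ioo (-1 : ℝ) 1 ∧
    HasDerivAt (fun y => Real.arcsin (u y / √(D y))) ((u' - u x * d' / (2 * D x)) / r) x := by
  have hD : 0 < D x := by rw [h]; positivity
  have hs : 0 < √(D x) := Real.sqrt_pos.mpr hD
  have hss : √(D x) ^ 2 = D x := Real.sq_sqrt hD.le
  have hlt : |u x| < √(D x) := by
    apply Real.lt_sqrt_of_sq_lt
    rw [sq_abs, h]
    nlinarith
  have hab := abs_lt.mp hlt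
  have h1 : -1 < u x / √(D x) := by rw [lt_div_iff₀ hs]; linarith
  have h2 : u x / √(D x) < 1 := by rw [div_lt_iff₀ hs]; linarith
  refine ⟨⟨h1, h2⟩, ?_⟩
  have hz := hu.fun_div (hd.sqrt hD.ne') hs.ne'
  have := (Real.hasDerivAt_arcsin h1.ne' h2.ne).comp x hz
  have hq : √(1 - (u x / √(D x)) ^ 2) = r / √(D x) := by
    rw [Real.sqrt_eq_iff_mul_self_eq_of_pos (by positivity)]
    rw [div_pow, hss, div_mul_div_comm, ← sq, ← sq, hss]
    field_simp
    linarith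
  rw [hq] at this
  refine this.congr_deriv ?_
  rw [hss]
  generalize √(D x) = s at *
  rw [← hss]
  field_simp

theorem zOne_aux (ω₀ : ℝ) (hω₀ : 0 < ω₀) (n₁ : ℕ) (hn₁ : 0 < n₁) (k₁ : ℝ)
    (q p : ℝ) (hq : 0 < q) (hp : 0 < p) :
    zOne ω₀ n₁ k₁ q p ∈ Set.Ioo (-1 : ℝ) 1 ∧ ∃ a : ℝ,
      HasDerivAt (fun x => Real.arcsin (zOne ω₀ n₁ k₁ q x)) (a * p) p ∧
      HasDerivAt (fun x => Real.arcsin (zOne ω₀ n₁ k₁ x p))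
        (a * (ω₀^2 * (n₁ : ℝ)^2 * q - k₁ / q^3) + 2 * (ω₀ * n₁) / p) q := by
  have hn : (0 : ℝ) < n₁ := by exact_mod_cast hn₁
  have hI1 : HasDerivAt (fun x => Ione ω₀ n₁ k₁ q x) p p := by
    unfold Ione
    refine (((((hasDerivAt_id p).pow 2).const_mul (1/2)).add_const _).add_const _).congr_deriv ?_
    simp
  have hI2 : HasDerivAt (fun x => Ione ω₀ n₁ k₁ x p) (ω₀^2 * (n₁ : ℝ)^2 * q - k₁ / q^3) q := by
    unfold Ione
    have h1 := ((hasDerivAt_id q).pow 2).const_mul ((1/2) * ω₀^2 * (n₁ : ℝ)^2)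
    have h2 := (hasDerivAt_const q k₁).fun_div (((hasDerivAt_id q).pow 2).const_mul 2)
      (by simp; positivity)
    refine ((h1.const_add ((1/2) * p^2)).add h2).congr_deriv ?_
    simp
    field_simp
    ring
  have hs2 : √2 ^ 2 = (2:ℝ) := Real.sq_sqrt (by norm_num)
  have hs : 0 < √(2:ℝ) := by positivity
  have key : (Ione ω₀ n₁ k₁ q p)^2 / (2 * ω₀^2 * (n₁ : ℝ)^2) - k₁ / 2 =
      ((ω₀ * (n₁ : ℝ) / √2) * (q^2 - Ione ω₀ n₁ k₁ q p / (ω₀^2 * (n₁ : ℝ)^2)))^2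
        + (q * p / √2)^2 := by
    have : q^2 * Ione ω₀ n₁ k₁ q p = q^2*p^2/2 + ω₀^2*n₁^2*q^4/2 + k₁/2 := by
      unfold Ione; field_simp
    generalize Ione ω₀ n₁ k₁ q p = I at *
    rw [mul_pow, div_pow, div_pow, hs2]
    field_simp
    linear_combination (2 * ω₀^2*n₁^2) * this
  have hr : 0 < q * p / √2 := by positivity
  have A := hasDerivAt_arcsin_aux
    (fun x => (ω₀ * (n₁ : ℝ) / √2) * (q^2 - Ione ω₀ n₁ k₁ q x / (ω₀^2 * (n₁ : ℝ)^2)))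
    (fun x => (Ione ω₀ n₁ k₁ q x)^2 / (2 * ω₀^2 * (n₁ : ℝ)^2) - k₁ / 2) _ _ _ p
    (((hI1.div_const _).const_sub _).const_mul _)
    (((hI1.pow 2).div_const _).sub_const _) hr key
  have B := hasDerivAt_arcsin_aux
    (fun x => (ω₀ * (n₁ : ℝ) / √2) * (x^2 - Ione ω₀ n₁ k₁ x p / (ω₀^2 * (n₁ : ℝ)^2)))
    (fun x => (Ione ω₀ n₁ k₁ x p)^2 / (2 * ω₀^2 * (n₁ : ℝ)^2) - k₁ / 2) _ _ _ q
    ((((hasDerivAt_id q).pow 2).sub (hI2.div_const _)).const_mul _)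
    (((hI2.pow 2).div_const _).sub_const _) hr key
  have hD : (Ione ω₀ n₁ k₁ q p)^2 / (2 * ω₀^2 * (n₁ : ℝ)^2) - k₁ / 2 ≠ 0 := by
    rw [key]; positivity
  refine ⟨A.1, ((ω₀ * (n₁ : ℝ) / √2) * (-(1 / (ω₀^2 * (n₁ : ℝ)^2)))
      - ((ω₀ * (n₁ : ℝ) / √2) * (q^2 - Ione ω₀ n₁ k₁ q p / (ω₀^2 * (n₁ : ℝ)^2)))
       * (2 * Ione ω₀ n₁ k₁ q p / (2 * ω₀^2 * (n₁ : ℝ)^2)) /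
       (2 * ((Ione ω₀ n₁ k₁ q p)^2 / (2 * ω₀^2 * (n₁ : ℝ)^2) - k₁ / 2))) / (q * p / √2),
    A.2.congr_deriv ?_, B.2.congr_deriv ?_⟩
  · simp only [Nat.cast_ofNat, Nat.add_one_sub_one, pow_one]
    ring
  · have e : 2 * (ω₀ * n₁) / p = (ω₀ * n₁ / √2 * (2 * q)) / (q * p / √2) := by
      field_simp
    rw [e]
    simp only [Nat.cast_ofNat, Nat.add_one_sub_one, pow_one, id]
    ring

theorem zTwo_aux (ω₀ : ℝ) (hω₀ : 0 < ω₀) (n₂ : ℕ) (hn₂ : 0 < n₂) (k₂ : ℝ)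
    (q p : ℝ) (hp : 0 < p) :
    zTwo ω₀ n₂ k₂ q p ∈ Set.Ioo (-1 : ℝ) 1 ∧ ∃ a : ℝ,
      HasDerivAt (fun x => Real.arcsin (zTwo ω₀ n₂ k₂ q x)) (a * p) p ∧
      HasDerivAt (fun x => Real.arcsin (zTwo ω₀ n₂ k₂ x p))
        (a * (ω₀^2 * (n₂ : ℝ)^2 * q + k₂) + (ω₀ * n₂) / p) q := by
  have hn : (0 : ℝ) < n₂ := by exact_mod_cast hn₂
  have hI1 : HasDerivAt (fun x => Itwo ω₀ n₂ k₂ q x) p p := by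
    unfold Itwo
    refine (((((hasDerivAt_id p).pow 2).const_mul (1/2)).add_const _).add_const _).congr_deriv ?_
    simp
  have hI2 : HasDerivAt (fun x => Itwo ω₀ n₂ k₂ x p) (ω₀^2 * (n₂ : ℝ)^2 * q + k₂) q := by
    unfold Itwo
    have h1 := ((hasDerivAt_id q).pow 2).const_mul ((1/2) * ω₀^2 * (n₂ : ℝ)^2)
    have h2 := (hasDerivAt_id q).const_mul k₂
    refine ((h1.const_add ((1/2) * p^2)).add h2).congr_deriv ?_
    simp
    ring
  have hs2 : √2 ^ 2 = (2:ℝ) := Real.sq_sqrt (by norm_num)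
  have hs : 0 < √(2:ℝ) := by positivity
  have key : Itwo ω₀ n₂ k₂ q p + k₂^2 / (2 * ω₀^2 * (n₂ : ℝ)^2) =
      ((ω₀ * (n₂ : ℝ) / √2) * (q + k₂ / (ω₀^2 * (n₂ : ℝ)^2)))^2 + (p / √2)^2 := by
    unfold Itwo
    rw [mul_pow, div_pow, div_pow, hs2]
    field_simp
    ring
  have hr : 0 < p / √2 := by positivity
  have A := hasDerivAt_arcsin_aux
    (fun x => (ω₀ * (n₂ : ℝ) / √2) * (q + k₂ / (ω₀^2 * (n₂ : ℝ)^2)))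
    (fun x => Itwo ω₀ n₂ k₂ q x + k₂^2 / (2 * ω₀^2 * (n₂ : ℝ)^2)) _ _ _ p
    (hasDerivAt_const _ _) (hI1.add_const _) hr key
  have B := hasDerivAt_arcsin_aux
    (fun x => (ω₀ * (n₂ : ℝ) / √2) * (x + k₂ / (ω₀^2 * (n₂ : ℝ)^2)))
    (fun x => Itwo ω₀ n₂ k₂ x p + k₂^2 / (2 * ω₀^2 * (n₂ : ℝ)^2)) _ _ _ q
    (((hasDerivAt_id q).add_const _).const_mul _) (hI2.add_const _) hr key
  refine ⟨A.1, (- ((ω₀ * (n₂ : ℝ) / √2) * (q + k₂ / (ω₀^2 * (n₂ : ℝ)^2))) /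
       (2 * (Itwo ω₀ n₂ k₂ q p + k₂^2 / (2 * ω₀^2 * (n₂ : ℝ)^2)))) / (p / √2),
    A.2.congr_deriv ?_, B.2.congr_deriv ?_⟩
  · ring
  · have e : (ω₀ * n₂) / p = (ω₀ * n₂ / √2) / (p / √2) := by
      field_simp
    rw [e]
    ring

/-- On the region `q₁ > 0, p₁ > 0, p₂ > 0`, both arcsine arguments lie in `(−1,1)` and the
angle-variable difference `X` is a constant of motion of
`H = (1/2)(p₁² + p₂²) + (1/2)ω₀²(n₁²q₁² + n₂²q₂²) + k₁/(2q₁²) + k₂q₂`. -/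
theorem angle_difference_constant_of_motion
    (ω₀ : ℝ) (hω₀ : 0 < ω₀) (n₁ n₂ : ℕ) (hn₁ : 0 < n₁) (hn₂ : 0 < n₂)
    (k₁ : ℝ) (hk₁ : 0 < k₁) (k₂ : ℝ) :
    ∀ q₁ q₂ p₁ p₂ : ℝ, 0 < q₁ → 0 < p₁ → 0 < p₂ →
      zOne ω₀ n₁ k₁ q₁ p₁ ∈ Set.Ioo (-1 : ℝ) 1 ∧
      zTwo ω₀ n₂ k₂ q₂ p₂ ∈ Set.Ioo (-1 : ℝ) 1 ∧
      poissonBracket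
        (fun q₁ q₂ p₁ p₂ =>
          (1/2) * (p₁^2 + p₂^2) + (1/2) * ω₀^2 * ((n₁ : ℝ)^2 * q₁^2 + (n₂ : ℝ)^2 * q₂^2)
            + k₁ / (2 * q₁^2) + k₂ * q₂)
        (Xint ω₀ n₁ n₂ k₁ k₂)
        q₁ q₂ p₁ p₂ = 0 := by
  intro q₁ q₂ p₁ p₂ hq₁ hp₁ hp₂
  obtain ⟨hz1, a, ha1, ha2⟩ := zOne_aux ω₀ hω₀ n₁ hn₁ k₁ q₁ p₁ hq₁ hp₁
  obtain ⟨hz2, b, hb1, hb2⟩ := zTwo_aux ω₀ hω₀ n₂ hn₂ k₂ q₂ p₂ hp₂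
  refine ⟨hz1, hz2, ?_⟩
  have hm₁ : (0 : ℝ) < n₁ := by exact_mod_cast hn₁
  have hm₂ : (0 : ℝ) < n₂ := by exact_mod_cast hn₂
  have F1 : HasDerivAt (fun x : ℝ => (1/2) * (p₁^2 + p₂^2) + (1/2) * ω₀^2 * ((n₁ : ℝ)^2 * x^2
      + (n₂ : ℝ)^2 * q₂^2) + k₁ / (2 * x^2) + k₂ * q₂)
      (ω₀^2 * (n₁ : ℝ)^2 * q₁ - k₁ / q₁^3) q₁ := by
    have h1 := ((((hasDerivAt_id q₁).pow 2).const_mul ((n₁ : ℝ)^2)).add_const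
      ((n₂ : ℝ)^2 * q₂^2)).const_mul ((1/2) * ω₀^2)
    have h2 := (hasDerivAt_const q₁ k₁).fun_div (((hasDerivAt_id q₁).pow 2).const_mul 2)
      (by simp; positivity)
    refine (((h1.const_add ((1/2) * (p₁^2 + p₂^2))).add h2).add_const _).congr_deriv ?_
    simp
    field_simp
    ring
  have F2 : HasDerivAt (fun x : ℝ => (1/2) * (p₁^2 + p₂^2) + (1/2) * ω₀^2 * ((n₁ : ℝ)^2 * q₁^2
      + (n₂ : ℝ)^2 * x^2) + k₁ / (2 * q₁^2) + k₂ * x)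
      (ω₀^2 * (n₂ : ℝ)^2 * q₂ + k₂) q₂ := by
    have h1 := ((((hasDerivAt_id q₂).pow 2).const_mul ((n₂ : ℝ)^2)).const_add
      ((n₁ : ℝ)^2 * q₁^2)).const_mul ((1/2) * ω₀^2)
    have h2 := (hasDerivAt_id q₂).const_mul k₂
    refine (((h1.const_add ((1/2) * (p₁^2 + p₂^2))).add_const _).add h2).congr_deriv ?_
    simp
    ring
  have F3 : HasDerivAt (fun x : ℝ => (1/2) * (x^2 + p₂^2) + (1/2) * ω₀^2 * ((n₁ : ℝ)^2 * q₁^2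
      + (n₂ : ℝ)^2 * q₂^2) + k₁ / (2 * q₁^2) + k₂ * q₂) p₁ p₁ := by
    refine (((((((hasDerivAt_id p₁).pow 2).add_const _).const_mul (1/2)).add_const
      _).add_const _).add_const _).congr_deriv ?_
    simp
  have F4 : HasDerivAt (fun x : ℝ => (1/2) * (p₁^2 + x^2) + (1/2) * ω₀^2 * ((n₁ : ℝ)^2 * q₁^2
      + (n₂ : ℝ)^2 * q₂^2) + k₁ / (2 * q₁^2) + k₂ * q₂) p₂ p₂ := by
    refine (((((((hasDerivAt_id p₂).pow 2).const_add _).const_mul (1/2)).add_const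
      _).add_const _).add_const _).congr_deriv ?_
    simp
  have G1 := (ha1.const_mul (1 / (2 * ω₀ * (n₁ : ℝ)))).sub_const
    ((1 / (ω₀ * (n₂ : ℝ))) * Real.arcsin (zTwo ω₀ n₂ k₂ q₂ p₂))
  have G2 := (ha2.const_mul (1 / (2 * ω₀ * (n₁ : ℝ)))).sub_const
    ((1 / (ω₀ * (n₂ : ℝ))) * Real.arcsin (zTwo ω₀ n₂ k₂ q₂ p₂))
  have G3 := (hb1.const_mul (1 / (ω₀ * (n₂ : ℝ)))).const_sub
    ((1 / (2 * ω₀ * (n₁ : ℝ))) * Real.arcsin (zOne ω₀ n₁ k₁ q₁ p₁))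
  have G4 := (hb2.const_mul (1 / (ω₀ * (n₂ : ℝ)))).const_sub
    ((1 / (2 * ω₀ * (n₁ : ℝ))) * Real.arcsin (zOne ω₀ n₁ k₁ q₁ p₁))
  unfold poissonBracket Xint
  rw [F1.deriv, F2.deriv, F3.deriv, F4.deriv, G1.deriv, G2.deriv, G3.deriv, G4.deriv]
  field_simp
  ring
end

section
/- Let λ₁, λ₂, μ₁, μ₂ ∈ ℝ and k₁, k₂ ∈ ℝ, and consider the position-dependent-mass Smorodinsky–Winternitz Hamiltonian H = (1/2)p₁²(λ₁ + μ₁q₁²)³ + (1/2)p₂²(λ₂ + μ₂q₂²)³ + k₁/q₁² + k₂/q₂² on the open set {q₁ ≠ 0, q₂ ≠ 0, λ₁ + μ₁q₁² ≠ 0, λ₂ + μ₂q₂² ≠ 0} ⊂ ℝ⁴. Then for i = 1, 2 the function I_i = (λ_i + μ_i q_i²)[λ_i(λ_i + μ_i q_i²)²p_i² + 2k_i/q_i²] satisfies {H, I_i} = 0, i.e. I₁ and I₂ are constants of motion. -/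
/-- The position-dependent-mass Smorodinsky–Winternitz Hamiltonian with masses
`m_i = (λ_i + μ_i q_i²)⁻³`. -/
noncomputable def pdmSW (lam₁ lam₂ mu₁ mu₂ k₁ k₂ : ℝ) : ℝ → ℝ → ℝ → ℝ → ℝ :=
  fun q₁ q₂ p₁ p₂ =>
    (1/2) * p₁^2 * (lam₁ + mu₁ * q₁^2)^3 + (1/2) * p₂^2 * (lam₂ + mu₂ * q₂^2)^3
      + k₁ / q₁^2 + k₂ / q₂^2

theorem aux_a (l m q : ℝ) : HasDerivAt (fun x : ℝ => l + m * x^2) (2 * m * q) q := by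
  have h := ((hasDerivAt_pow 2 q).const_mul m).const_add l
  refine h.congr_deriv ?_
  norm_num
  ring

theorem aux_k (k q : ℝ) (hq : q ≠ 0) :
    HasDerivAt (fun x : ℝ => k / x^2) (-2 * k / q^3) q := by
  have h := (hasDerivAt_const q k).fun_div (hasDerivAt_pow 2 q) (pow_ne_zero 2 hq)
  refine h.congr_deriv ?_
  norm_num
  field_simp

theorem aux_Hq (l m k p q : ℝ) (hq : q ≠ 0) :
    HasDerivAt (fun x : ℝ => (1/2) * p^2 * (l + m * x^2)^3 + k / x^2)
      (3 * p^2 * (l + m * q^2)^2 * m * q - 2 * k / q^3) q := by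
  have h := (((aux_a l m q).fun_pow 3).const_mul ((1/2) * p^2)).fun_add (aux_k k q hq)
  refine h.congr_deriv ?_
  norm_num
  ring

theorem aux_Iq (l m k p q : ℝ) (hq : q ≠ 0) :
    HasDerivAt (fun x : ℝ => (l + m * x^2) * (l * (l + m * x^2)^2 * p^2 + 2 * k / x^2))
      (2 * l * (3 * p^2 * (l + m * q^2)^2 * m * q - 2 * k / q^3)) q := by
  have h := (aux_a l m q).fun_mul
    (((((aux_a l m q).fun_pow 2).const_mul l).mul_const (p^2)).fun_add (aux_k (2 * k) q hq))
  refine h.congr_deriv ?_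
  norm_num
  field_simp
  ring

theorem aux_Hp (A p : ℝ) : HasDerivAt (fun x : ℝ => (1/2) * x^2 * A) (p * A) p := by
  have h := ((hasDerivAt_pow 2 p).const_mul (1/2 : ℝ)).mul_const A
  refine h.congr_deriv ?_
  push_cast; ring

theorem aux_Ip (a l c p : ℝ) :
    HasDerivAt (fun x : ℝ => a * (l * a^2 * x^2 + c)) (2 * l * (p * a^3)) p := by
  have h := (((hasDerivAt_pow 2 p).const_mul (l * a^2)).add_const c).const_mul a
  refine h.congr_deriv ?_
  norm_num
  ring

/-- The functions `I_i = (λ_i + μ_i q_i²)[λ_i(λ_i + μ_i q_i²)²p_i² + 2k_i/q_i²]`, `i = 1,2`,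
are constants of motion of the position-dependent-mass Smorodinsky–Winternitz system. -/
theorem pdm_SW_separated_integrals (lam₁ lam₂ mu₁ mu₂ k₁ k₂ : ℝ) :
    ∀ q₁ q₂ p₁ p₂ : ℝ, q₁ ≠ 0 → q₂ ≠ 0 →
      lam₁ + mu₁ * q₁^2 ≠ 0 → lam₂ + mu₂ * q₂^2 ≠ 0 →
      poissonBracket (pdmSW lam₁ lam₂ mu₁ mu₂ k₁ k₂)
        (fun q₁ q₂ p₁ p₂ =>
          (lam₁ + mu₁ * q₁^2) * (lam₁ * (lam₁ + mu₁ * q₁^2)^2 * p₁^2 + 2 * k₁ / q₁^2))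
        q₁ q₂ p₁ p₂ = 0 ∧
      poissonBracket (pdmSW lam₁ lam₂ mu₁ mu₂ k₁ k₂)
        (fun q₁ q₂ p₁ p₂ =>
          (lam₂ + mu₂ * q₂^2) * (lam₂ * (lam₂ + mu₂ * q₂^2)^2 * p₂^2 + 2 * k₂ / q₂^2))
        q₁ q₂ p₁ p₂ = 0 := by
  intro q₁ q₂ p₁ p₂ h1 h2 _ _
  have e1 : deriv (fun x => pdmSW lam₁ lam₂ mu₁ mu₂ k₁ k₂ x q₂ p₁ p₂) q₁ =
      3 * p₁^2 * (lam₁ + mu₁ * q₁^2)^2 * mu₁ * q₁ - 2 * k₁ / q₁^3 := by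
    have h := (aux_Hq lam₁ mu₁ k₁ p₁ q₁ h1).add_const
      ((1/2) * p₂^2 * (lam₂ + mu₂ * q₂^2)^3 + k₂ / q₂^2)
    rw [← h.deriv]
    congr 1
    funext x
    simp only [pdmSW]
    ring
  have e2 : deriv (fun x => pdmSW lam₁ lam₂ mu₁ mu₂ k₁ k₂ q₁ x p₁ p₂) q₂ =
      3 * p₂^2 * (lam₂ + mu₂ * q₂^2)^2 * mu₂ * q₂ - 2 * k₂ / q₂^3 := by
    have h := (aux_Hq lam₂ mu₂ k₂ p₂ q₂ h2).add_const
      ((1/2) * p₁^2 * (lam₁ + mu₁ * q₁^2)^3 + k₁ / q₁^2)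
    rw [← h.deriv]
    congr 1
    funext x
    simp only [pdmSW]
    ring
  have e3 : deriv (fun x => pdmSW lam₁ lam₂ mu₁ mu₂ k₁ k₂ q₁ q₂ x p₂) p₁ =
      p₁ * (lam₁ + mu₁ * q₁^2)^3 := by
    have h := (aux_Hp ((lam₁ + mu₁ * q₁^2)^3) p₁).add_const
      ((1/2) * p₂^2 * (lam₂ + mu₂ * q₂^2)^3 + k₁ / q₁^2 + k₂ / q₂^2)
    rw [← h.deriv]
    congr 1
    funext x
    simp only [pdmSW]
    ring
  have e4 : deriv (fun x => pdmSW lam₁ lam₂ mu₁ mu₂ k₁ k₂ q₁ q₂ p₁ x) p₂ =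
      p₂ * (lam₂ + mu₂ * q₂^2)^3 := by
    have h := (aux_Hp ((lam₂ + mu₂ * q₂^2)^3) p₂).add_const
      ((1/2) * p₁^2 * (lam₁ + mu₁ * q₁^2)^3 + k₁ / q₁^2 + k₂ / q₂^2)
    rw [← h.deriv]
    congr 1
    funext x
    simp only [pdmSW]
    ring
  constructor
  · unfold poissonBracket
    rw [e1, e2, e3, e4, (aux_Iq lam₁ mu₁ k₁ p₁ q₁ h1).deriv,
      (aux_Ip (lam₁ + mu₁ * q₁^2) lam₁ (2 * k₁ / q₁^2) p₁).deriv, deriv_const, deriv_const]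
    ring
  · unfold poissonBracket
    rw [e1, e2, e3, e4, (aux_Iq lam₂ mu₂ k₂ p₂ q₂ h2).deriv,
      (aux_Ip (lam₂ + mu₂ * q₂^2) lam₂ (2 * k₂ / q₂^2) p₂).deriv, deriv_const, deriv_const]
    ring
end

section
/- Let ω₀ > 0, n₁ ∈ ℝ, k₁ ∈ ℝ, k₂ ∈ ℝ, n₂ ∈ ℝ, and let H = (1/2)(p₁² + p₂²) + (1/2)ω₀²(n₁²q₁² + n₂²q₂²) + k₁/(2q₁²) + k₂/(2q₂²) on {q₁ ≠ 0, q₂ ≠ 0} ⊂ ℝ⁴. Let (q₁(t),q₂(t),p₁(t),p₂(t)) be a solution of Hamilton's equations for H with q₁(t) ≠ 0 for all t, and define the complex function B₁(t) = (p₁(t) + i n₁ω₀ q₁(t))² + k₁/q₁(t)². Then B₁ satisfies the linear ODE dB₁/dt = 2 i n₁ ω₀ B₁. -/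
open Complex

/-- Along any solution of Hamilton's equations for
`H = (1/2)(p₁² + p₂²) + (1/2)ω₀²(n₁²q₁² + n₂²q₂²) + k₁/(2q₁²) + k₂/(2q₂²)`
with `q₁(t) ≠ 0`, the complex factorization function
`B₁(t) = (p₁(t) + i n₁ω₀ q₁(t))² + k₁/q₁(t)²` satisfies `dB₁/dt = 2 i n₁ ω₀ B₁`. -/
theorem pdm_complex_factorization_ODE
    (ω₀ : ℝ) (hω₀ : 0 < ω₀) (n₁ n₂ k₁ k₂ : ℝ)
    (q₁ q₂ p₁ p₂ : ℝ → ℝ)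
    (hq₁ : ∀ t, q₁ t ≠ 0)
    (hq₁' : ∀ t, HasDerivAt q₁ (p₁ t) t)
    (hq₂' : ∀ t, HasDerivAt q₂ (p₂ t) t)
    (hp₁' : ∀ t, HasDerivAt p₁ (-(ω₀^2 * n₁^2 * q₁ t) + k₁ / (q₁ t)^3) t)
    (hp₂' : ∀ t, HasDerivAt p₂ (-(ω₀^2 * n₂^2 * q₂ t) + k₂ / (q₂ t)^3) t) :
    ∀ t, HasDerivAt
      (fun t => (((p₁ t : ℂ) + Complex.I * n₁ * ω₀ * q₁ t)^2 + (k₁ : ℂ) / (q₁ t : ℂ)^2))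
      (2 * Complex.I * n₁ * ω₀ *
        (((p₁ t : ℂ) + Complex.I * n₁ * ω₀ * q₁ t)^2 + (k₁ : ℂ) / (q₁ t : ℂ)^2)) t := by
  intro t
  have hq := (hq₁' t).ofReal_comp
  have hp := (hp₁' t).ofReal_comp
  have hne : (q₁ t : ℂ) ≠ 0 := Complex.ofReal_ne_zero.mpr (hq₁ t)
  have h1 := (hp.add (hq.const_mul (Complex.I * n₁ * ω₀))).pow 2
  have h2 := (hasDerivAt_const t (k₁ : ℂ)).div (hq.pow 2) (pow_ne_zero 2 hne)
  refine (h1.add h2).congr_deriv ?_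
  have hI : Complex.I ^ 2 = -1 := Complex.I_sq
  simp only [Pi.add_apply, Pi.pow_apply]
  push_cast
  field_simp
  ring_nf
  try simp only [Complex.I_sq, Complex.I_pow_three]
  try ring
end

section
/- Let ω₀ > 0, let n₁, n₂ be positive integers, k₁, k₂ ∈ ℝ, and let H = (1/2)(p₁² + p₂²) + (1/2)ω₀²(n₁²q₁² + n₂²q₂²) + k₁/(2q₁²) + k₂/(2q₂²) on {q₁ ≠ 0, q₂ ≠ 0} ⊂ ℝ⁴. Define the complex functions B₁ = (p₁ + i n₁ω₀ q₁)² + k₁/q₁² and B₂ = (p₂ + i n₂ω₀ q₂)² + k₂/q₂², and set B₁₂ = B₁^{n₂} (conj(B₂))^{n₁}. Then the real and imaginary parts of B₁₂ are constants of motion of H: {H, Re(B₁₂)} = 0 and {H, Im(B₁₂)} = 0 on {q₁ ≠ 0, q₂ ≠ 0}. -/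
/-- The complex factorization function `B₁ = (p₁ + i n₁ω₀ q₁)² + k₁/q₁²`. -/
noncomputable def Bone (ω₀ : ℝ) (n₁ : ℕ) (k₁ : ℝ) (q₁ p₁ : ℝ) : ℂ :=
  ((p₁ : ℂ) + Complex.I * (n₁ : ℂ) * (ω₀ : ℂ) * (q₁ : ℂ))^2 + (k₁ : ℂ) / (q₁ : ℂ)^2

/-- The complex factorization function `B₂ = (p₂ + i n₂ω₀ q₂)² + k₂/q₂²`. -/
noncomputable def Btwo (ω₀ : ℝ) (n₂ : ℕ) (k₂ : ℝ) (q₂ p₂ : ℝ) : ℂ :=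
  ((p₂ : ℂ) + Complex.I * (n₂ : ℂ) * (ω₀ : ℂ) * (q₂ : ℂ))^2 + (k₂ : ℂ) / (q₂ : ℂ)^2

/-- `B₁₂ = B₁^{n₂} (conj B₂)^{n₁}` as a complex function on phase space. -/
noncomputable def B12 (ω₀ : ℝ) (n₁ n₂ : ℕ) (k₁ k₂ : ℝ) (q₁ q₂ p₁ p₂ : ℝ) : ℂ :=
  (Bone ω₀ n₁ k₁ q₁ p₁) ^ n₂ * (starRingEnd ℂ (Btwo ω₀ n₂ k₂ q₂ p₂)) ^ n₁

lemma bone_q (ω : ℝ) (n : ℕ) (k q p : ℝ) (hq : q ≠ 0) :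
    HasDerivAt (fun x : ℝ => Bone ω n k x p)
      (2 * ((p : ℂ) + Complex.I * n * ω * q) * (Complex.I * n * ω) - 2 * k / (q : ℂ)^3) q := by
  have hq' : (q : ℂ) ≠ 0 := by exact_mod_cast hq
  have hx : HasDerivAt (fun x : ℝ => (x : ℂ)) 1 q := Complex.ofRealCLM.hasDerivAt
  have h1 := ((hx.const_mul (Complex.I * n * ω)).const_add (p : ℂ)).pow 2
  have h2 := (hasDerivAt_const q (k : ℂ)).div (hx.pow 2) (pow_ne_zero 2 hq')
  refine (h1.add h2).congr_deriv ?_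
  simp only [Pi.pow_apply]
  push_cast
  field_simp
  ring

lemma bone_p (ω : ℝ) (n : ℕ) (k q p : ℝ) :
    HasDerivAt (fun x : ℝ => Bone ω n k q x)
      (2 * ((p : ℂ) + Complex.I * n * ω * q)) p := by
  have hx : HasDerivAt (fun x : ℝ => (x : ℂ)) 1 p := Complex.ofRealCLM.hasDerivAt
  have h1 := ((hx.add_const (Complex.I * n * ω * q)).pow 2).add_const ((k : ℂ) / (q : ℂ)^2)
  refine h1.congr_deriv ?_
  push_cast
  ring

/-- the flow identity for one factor -/
lemma bone_flow (ω : ℝ) (n : ℕ) (k q p : ℝ) (hq : q ≠ 0) :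
    ((ω^2 * n^2 * q - k / q^3 : ℝ) : ℂ) * (2 * ((p : ℂ) + Complex.I * n * ω * q))
     - (p : ℂ) * (2 * ((p : ℂ) + Complex.I * n * ω * q) * (Complex.I * n * ω)
        - 2 * k / (q : ℂ)^3) = - (2 * Complex.I * n * ω) * Bone ω n k q p := by
  have hq' : (q : ℂ) ≠ 0 := by exact_mod_cast hq
  unfold Bone
  push_cast
  field_simp
  ring_nf
  simp only [Complex.I_sq, show Complex.I ^ 3 = -Complex.I from by rw [pow_succ, Complex.I_sq]; ring]
  ring

lemma pot_deriv (c d k q : ℝ) (hq : q ≠ 0) :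
    HasDerivAt (fun x : ℝ => d + (1/2) * c * x^2 + k / (2 * x^2)) (c * q - k / q^3) q := by
  have h1 := ((hasDerivAt_id q).pow 2).const_mul ((1/2) * c)
  have h2 := (hasDerivAt_const q k).div (((hasDerivAt_id q).pow 2).const_mul 2)
    (by simp [hq] : (2 * (id ^ 2 : ℝ → ℝ) q) ≠ 0)
  refine ((h1.const_add d).add h2).congr_deriv ?_
  simp only [Pi.pow_apply, id]
  push_cast
  field_simp
  ring

lemma re_deriv {f : ℝ → ℂ} {f' : ℂ} {x : ℝ} (h : HasDerivAt f f' x) :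
    deriv (fun y => (f y).re) x = f'.re :=
  (Complex.reCLM.hasFDerivAt.comp_hasDerivAt x h).deriv

lemma im_deriv {f : ℝ → ℂ} {f' : ℂ} {x : ℝ} (h : HasDerivAt f f' x) :
    deriv (fun y => (f y).im) x = f'.im :=
  (Complex.imCLM.hasFDerivAt.comp_hasDerivAt x h).deriv

lemma conj_deriv {f : ℝ → ℂ} {f' : ℂ} {x : ℝ} (h : HasDerivAt f f' x) :
    HasDerivAt (fun y => starRingEnd ℂ (f y)) (starRingEnd ℂ f') x :=
  (Complex.conjCLE.toContinuousLinearMap.hasFDerivAt.comp_hasDerivAt x h)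

lemma core (n m : ℕ) (hn : 0 < n) (hm : 0 < m) (w B C a b a' b' x y x' y' : ℂ)
    (h1 : x * b - y * a = - (2 * Complex.I * n * w) * B)
    (h2 : x' * b' - y' * a' = (2 * Complex.I * m * w) * C) :
    x * (m * B^(m-1) * b * C^n) + x' * (B^m * (n * C^(n-1) * b'))
     - y * (m * B^(m-1) * a * C^n) - y' * (B^m * (n * C^(n-1) * a')) = 0 := by
  obtain ⟨n, rfl⟩ := Nat.exists_eq_succ_of_ne_zero hn.ne'
  obtain ⟨m, rfl⟩ := Nat.exists_eq_succ_of_ne_zero hm.ne'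
  simp only [Nat.succ_eq_add_one, Nat.add_sub_cancel] at *
  push_cast at *
  linear_combination ((m+1) * B^m * C^(n+1)) * h1 + ((n+1) * C^n * B^(m+1)) * h2

/-- The real and imaginary parts of `B₁₂ = B₁^{n₂}(conj B₂)^{n₁}` are constants of motion of
the Hamiltonian `H = (1/2)(p₁²+p₂²) + (1/2)ω₀²(n₁²q₁²+n₂²q₂²) + k₁/(2q₁²) + k₂/(2q₂²)`. -/
theorem complex_factorization_integrals
    (ω₀ : ℝ) (hω₀ : 0 < ω₀) (n₁ n₂ : ℕ) (hn₁ : 0 < n₁) (hn₂ : 0 < n₂) (k₁ k₂ : ℝ) :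
    ∀ q₁ q₂ p₁ p₂ : ℝ, q₁ ≠ 0 → q₂ ≠ 0 →
      poissonBracket
        (fun q₁ q₂ p₁ p₂ =>
          (1/2) * (p₁^2 + p₂^2) + (1/2) * ω₀^2 * ((n₁ : ℝ)^2 * q₁^2 + (n₂ : ℝ)^2 * q₂^2)
            + k₁ / (2 * q₁^2) + k₂ / (2 * q₂^2))
        (fun q₁ q₂ p₁ p₂ => (B12 ω₀ n₁ n₂ k₁ k₂ q₁ q₂ p₁ p₂).re)
        q₁ q₂ p₁ p₂ = 0 ∧
      poissonBracket
        (fun q₁ q₂ p₁ p₂ =>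
          (1/2) * (p₁^2 + p₂^2) + (1/2) * ω₀^2 * ((n₁ : ℝ)^2 * q₁^2 + (n₂ : ℝ)^2 * q₂^2)
            + k₁ / (2 * q₁^2) + k₂ / (2 * q₂^2))
        (fun q₁ q₂ p₁ p₂ => (B12 ω₀ n₁ n₂ k₁ k₂ q₁ q₂ p₁ p₂).im)
        q₁ q₂ p₁ p₂ = 0 := by
  intro q₁ q₂ p₁ p₂ hq₁ hq₂
  have dq₁ := ((bone_q ω₀ n₁ k₁ q₁ p₁ hq₁).fun_pow n₂).mul_const
    ((starRingEnd ℂ (Bone ω₀ n₂ k₂ q₂ p₂)) ^ n₁)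
  have dp₁ := ((bone_p ω₀ n₁ k₁ q₁ p₁).fun_pow n₂).mul_const
    ((starRingEnd ℂ (Bone ω₀ n₂ k₂ q₂ p₂)) ^ n₁)
  have dq₂ := ((conj_deriv (bone_q ω₀ n₂ k₂ q₂ p₂ hq₂)).fun_pow n₁).const_mul
    ((Bone ω₀ n₁ k₁ q₁ p₁) ^ n₂)
  have dp₂ := ((conj_deriv (bone_p ω₀ n₂ k₂ q₂ p₂)).fun_pow n₁).const_mul
    ((Bone ω₀ n₁ k₁ q₁ p₁) ^ n₂)
  have f₁ := bone_flow ω₀ n₁ k₁ q₁ p₁ hq₁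
  have f₂ := congrArg (starRingEnd ℂ) (bone_flow ω₀ n₂ k₂ q₂ p₂ hq₂)
  rw [map_sub, map_mul, map_mul (starRingEnd ℂ) (p₂ : ℂ), map_mul (starRingEnd ℂ) (-_),
    Complex.conj_ofReal, Complex.conj_ofReal,
    show (starRingEnd ℂ) (-(2 * Complex.I * n₂ * ω₀)) = 2 * Complex.I * n₂ * ω₀ by simp [Complex.conj_ofNat]] at f₂
  have key := core n₁ n₂ hn₁ hn₂ _ _ _ _ _ _ _ _ _ _ _ f₁ f₂
  have e₁ : deriv (fun x : ℝ => (1/2) * (p₁^2 + p₂^2)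
      + (1/2) * ω₀^2 * ((n₁ : ℝ)^2 * x^2 + (n₂ : ℝ)^2 * q₂^2)
      + k₁ / (2 * x^2) + k₂ / (2 * q₂^2)) q₁ = ω₀^2 * n₁^2 * q₁ - k₁ / q₁^3 := by
    rw [← (pot_deriv (ω₀^2 * n₁^2) ((1/2) * (p₁^2 + p₂^2) + (1/2) * ω₀^2 * ((n₂ : ℝ)^2 * q₂^2)
      + k₂ / (2 * q₂^2)) k₁ q₁ hq₁).deriv]
    congr 1; funext x; ring
  have e₂ : deriv (fun x : ℝ => (1/2) * (p₁^2 + p₂^2)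
      + (1/2) * ω₀^2 * ((n₁ : ℝ)^2 * q₁^2 + (n₂ : ℝ)^2 * x^2)
      + k₁ / (2 * q₁^2) + k₂ / (2 * x^2)) q₂ = ω₀^2 * n₂^2 * q₂ - k₂ / q₂^3 := by
    rw [← (pot_deriv (ω₀^2 * n₂^2) ((1/2) * (p₁^2 + p₂^2) + (1/2) * ω₀^2 * ((n₁ : ℝ)^2 * q₁^2)
      + k₁ / (2 * q₁^2)) k₂ q₂ hq₂).deriv]
    congr 1; funext x; ring
  have kin : ∀ d p : ℝ, deriv (fun x : ℝ => (1/2) * x^2 + d) p = p := by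
    intro d p
    have := (((hasDerivAt_id p).pow 2).const_mul (1/2)).add_const d
    exact (this.congr_deriv (by simp)).deriv
  have e₃ : deriv (fun x : ℝ => (1/2) * (x^2 + p₂^2)
      + (1/2) * ω₀^2 * ((n₁ : ℝ)^2 * q₁^2 + (n₂ : ℝ)^2 * q₂^2)
      + k₁ / (2 * q₁^2) + k₂ / (2 * q₂^2)) p₁ = p₁ := by
    conv_rhs => rw [← kin ((1/2) * p₂^2 + (1/2) * ω₀^2 * ((n₁ : ℝ)^2 * q₁^2 + (n₂ : ℝ)^2 * q₂^2)
      + k₁ / (2 * q₁^2) + k₂ / (2 * q₂^2)) p₁]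
    congr 1; funext x; ring
  have e₄ : deriv (fun x : ℝ => (1/2) * (p₁^2 + x^2)
      + (1/2) * ω₀^2 * ((n₁ : ℝ)^2 * q₁^2 + (n₂ : ℝ)^2 * q₂^2)
      + k₁ / (2 * q₁^2) + k₂ / (2 * q₂^2)) p₂ = p₂ := by
    conv_rhs => rw [← kin ((1/2) * p₁^2 + (1/2) * ω₀^2 * ((n₁ : ℝ)^2 * q₁^2 + (n₂ : ℝ)^2 * q₂^2)
      + k₁ / (2 * q₁^2) + k₂ / (2 * q₂^2)) p₂]
    congr 1; funext x; ring
  constructor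
  · have r := congrArg Complex.re key
    rw [Complex.sub_re, Complex.sub_re, Complex.add_re, Complex.re_ofReal_mul,
      Complex.re_ofReal_mul, Complex.re_ofReal_mul, Complex.re_ofReal_mul,
      ← re_deriv dq₁, ← re_deriv dp₁, ← re_deriv dq₂, ← re_deriv dp₂] at r
    unfold poissonBracket
    rw [e₁, e₂, e₃, e₄]
    exact r
  · have r := congrArg Complex.im key
    rw [Complex.sub_im, Complex.sub_im, Complex.add_im, Complex.im_ofReal_mul,
      Complex.im_ofReal_mul, Complex.im_ofReal_mul, Complex.im_ofReal_mul,
      ← im_deriv dq₁, ← im_deriv dp₁, ← im_deriv dq₂, ← im_deriv dp₂] at r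
    unfold poissonBracket
    rw [e₁, e₂, e₃, e₄]
    exact r
end
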